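/- arXiv:2201.10955 — 3 statements merged into one kernel-verified Lean document; each statement's English description precedes it below -/
import Mathlib

section
/- Let A, B, C, D be integers with gcd(A, B, C, D) = 1 and Δ := A·D − B·C ≠ 0. Then for every ε > 0 there is a constant C = C(ε, A, B, C, D) such that for all integers N ≥ 1 and H ≥ 1, Σ_{n=1}^{N} |Σ_{H ≤ q < 2H} 𝔖_q(n)|² ≤ C · H^ε · (H + N·H^{−1/2}). -/
/-- The Ramanujan sum `c_q(x) = Σ_{r (mod q), gcd(r,q)=1} e^{2πi r x / q}`,
viewed as a function of `x ∈ ℤ/qℤ`. -/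
noncomputable def ramanujanSum (q : ℕ) (x : ZMod q) : ℂ :=
  ∑ r ∈ (Finset.range q).filter (fun r => Nat.Coprime r q),
    Complex.exp (2 * Real.pi * Complex.I * ((r * x.val : ℕ) : ℂ) / q)

/-- The linear form `ℒ(γ) = A·a + B·b + C·c + D·d` on `SL₂(ℤ/qℤ)`. -/
def Lform (A B C D : ℤ) {q : ℕ} (γ : Matrix.SpecialLinearGroup (Fin 2) (ZMod q)) : ZMod q :=
  (A : ZMod q) * γ.1 0 0 + (B : ZMod q) * γ.1 0 1 +
    (C : ZMod q) * γ.1 1 0 + (D : ZMod q) * γ.1 1 1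

/-- The singular series term `𝔖_q(n) = |SL₂(ℤ/qℤ)|⁻¹ Σ_{γ ∈ SL₂(ℤ/qℤ)} c_q(ℒ(γ) − n)`
(a real number), with junk value `0` at `q = 0`. -/
noncomputable def singSeriesTerm (A B C D : ℤ) (q : ℕ) (n : ℤ) : ℝ :=
  if h : q = 0 then 0 else
    haveI : NeZero q := ⟨h⟩
    ((Fintype.card (Matrix.SpecialLinearGroup (Fin 2) (ZMod q)) : ℂ)⁻¹ *
      ∑ γ : Matrix.SpecialLinearGroup (Fin 2) (ZMod q),
        ramanujanSum q (Lform A B C D γ - (n : ZMod q))).re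

section Auxiliary

open Finset

section BilinearSums

theorem sum_matrix_fin_two {R M : Type*} [Fintype R] [AddCommMonoid M] (f : Matrix (Fin 2) (Fin 2) R → M) :
    ∑ m, f m = ∑ a, ∑ d, ∑ b, ∑ c, f !![a, b; c, d] := by
  trans ∑ p : ((R × R) × R) × R, f !![p.1.1.1, p.1.2; p.2, p.1.1.2]
  swap
  · simp_rw [Fintype.sum_prod_type]
  refine Fintype.sum_equiv
    ⟨fun m => ((((m 0 0, m 1 1), m 0 1), m 1 0)), fun p => !![p.1.1.1, p.1.2; p.2, p.1.1.2],
      fun m => ?_, fun p => ?_⟩ _ _ fun m => ?_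
  · ext i j
    fin_cases i <;> fin_cases j <;> rfl
  · simp
  · congr 1
    ext i j
    fin_cases i <;> fin_cases j <;> rfl

variable {R : Type*} [CommRing R] [Fintype R] [DecidableEq R] {ψ : AddChar R ℂ}

theorem sum_addChar_bilinear (hψ : ψ.IsPrimitive) (s x y : R) :
    ∑ a, ∑ d, ψ (s * (a * d) + x * a + y * d) =
      Fintype.card R * ∑ d, if s * d + x = 0 then ψ (y * d) else 0 := by
  rw [sum_comm, mul_sum]
  refine sum_congr rfl fun d _ => ?_
  have h (a : R) : ψ (s * (a * d) + x * a + y * d) = ψ (a * (s * d + x)) * ψ (y * d) := by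
    rw [← AddChar.map_add_eq_mul]
    ring_nf
  simp_rw [h]
  rw [← sum_mul, AddChar.sum_mulShift _ hψ]
  split_ifs <;> simp

theorem sum_addChar_bilinear_unit (hψ : ψ.IsPrimitive) (s : Rˣ) (x y : R) :
    ∑ a, ∑ d, ψ (s * (a * d) + x * a + y * d) =
      Fintype.card R * ψ (-(x * y * (s⁻¹ : Rˣ))) := by
  rw [sum_addChar_bilinear hψ]
  congr 1
  have h (d : R) : (s * d + x = 0) ↔ d = -(x * (s⁻¹ : Rˣ)) := by
    constructor
    · intro h
      have h' := congrArg (fun t => t * ((s⁻¹ : Rˣ) : R)) h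
      linear_combination h' - d * s.mul_inv
    · rintro rfl
      linear_combination -x * s.mul_inv
  simp_rw [h]
  simp only [sum_ite_eq', mem_univ, if_true]
  congr 1
  ring

theorem dvd_of_sum_addChar_bilinear_ne_zero (hψ : ψ.IsPrimitive) {s x y : R}
    (h : ∑ a, ∑ d, ψ (s * (a * d) + x * a + y * d) ≠ 0) : s ∣ x := by
  rw [sum_addChar_bilinear hψ] at h
  obtain ⟨d, -, hd⟩ := exists_ne_zero_of_sum_ne_zero (right_ne_zero_of_mul h)
  have hd' : s * d + x = 0 := by
    by_contra h0
    exact hd (if_neg h0)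
  exact ⟨-d, by linear_combination hd'⟩

theorem dvd_and_dvd_of_sum_addChar_bilinear_ne_zero (hψ : ψ.IsPrimitive) {s x y : R}
    (h : ∑ a, ∑ d, ψ (s * (a * d) + x * a + y * d) ≠ 0) : s ∣ x ∧ s ∣ y := by
  refine ⟨dvd_of_sum_addChar_bilinear_ne_zero hψ h,
    dvd_of_sum_addChar_bilinear_ne_zero (y := x) hψ ?_⟩
  rw [sum_comm] at h
  have hswap (a d : R) : s * (a * d) + y * a + x * d = s * (d * a) + x * d + y * a := by ring
  simpa only [hswap] using h

/-- The Kloosterman sum `∑ ψ (-(s + v s⁻¹))` over the units `s` of a finite ring. -/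
noncomputable def kloostermanSum (ψ : AddChar R ℂ) (v : R) : ℂ :=
  ∑ s : Rˣ, ψ (-(s + v * (s⁻¹ : Rˣ)))

theorem sum_specialLinearGroup_addChar (hψ : ψ.IsPrimitive) {A B C D : R} {w x y z : R}
    (hprim : w * A + x * B + y * C + z * D = 1) (u : Rˣ) :
    ∑ γ : Matrix.SpecialLinearGroup (Fin 2) R,
        ψ (u * (A * γ.1 0 0 + B * γ.1 0 1 + C * γ.1 1 0 + D * γ.1 1 1)) =
      Fintype.card R * kloostermanSum ψ ((A * D - B * C) * (u * u)) := by
  have hcard : (Fintype.card R : ℂ) ≠ 0 := by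
    exact_mod_cast Fintype.card_ne_zero
  let f : Matrix (Fin 2) (Fin 2) R → ℂ := fun m =>
    ψ (u * (A * m 0 0 + B * m 0 1 + C * m 1 0 + D * m 1 1))
  have hsub : ∑ γ : Matrix.SpecialLinearGroup (Fin 2) R, f γ.1 =
      ∑ m, if m.det = 1 then f m else 0 := by
    rw [← sum_filter]
    exact (sum_subtype (univ.filter fun m : Matrix (Fin 2) (Fin 2) R => m.det = 1)
      (by simp) f).symm
  have hdet (m : Matrix (Fin 2) (Fin 2) R) :
      (Fintype.card R : ℂ) * (if m.det = 1 then f m else 0) =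
        ∑ s, ψ (s * (m.det - 1)) * f m := by
    rw [← sum_mul, AddChar.sum_mulShift _ hψ]
    simp only [sub_eq_zero]
    split_ifs <;> simp
  have hfactor (s : R) : ∑ m, ψ (s * (m.det - 1)) * f m =
      ψ (-s) * ((∑ a, ∑ d, ψ (s * (a * d) + (u * A) * a + (u * D) * d)) *
        ∑ b, ∑ c, ψ (-s * (b * c) + (u * B) * b + (u * C) * c)) := by
    rw [sum_matrix_fin_two]
    simp_rw [sum_mul, mul_sum, f, Matrix.det_fin_two_of]
    refine sum_congr rfl fun a _ => sum_congr rfl fun d _ => sum_congr rfl fun b _ =>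
      sum_congr rfl fun c _ => ?_
    simp only [← AddChar.map_add_eq_mul]
    congr 1
    simp
    ring
  have hnonunit (s : R) (hs : ¬ IsUnit s) : ∑ m, ψ (s * (m.det - 1)) * f m = 0 := by
    rw [hfactor]
    by_contra h
    have h1 := dvd_and_dvd_of_sum_addChar_bilinear_ne_zero hψ
      (left_ne_zero_of_mul (right_ne_zero_of_mul h))
    have h2 := dvd_and_dvd_of_sum_addChar_bilinear_ne_zero hψ
      (right_ne_zero_of_mul (right_ne_zero_of_mul h))
    simp only [Units.dvd_mul_left, neg_dvd] at h1 h2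
    refine hs (isUnit_of_dvd_one ?_)
    rw [← hprim]
    exact dvd_add (dvd_add (dvd_add (h1.1.mul_left _) (h2.1.mul_left _)) (h2.2.mul_left _))
      (h1.2.mul_left _)
  have hunit (s : Rˣ) : ∑ m, ψ (s * (m.det - 1)) * f m =
      Fintype.card R * (Fintype.card R *
        ψ (-(s + (A * D - B * C) * (u * u) * (s⁻¹ : Rˣ)))) := by
    rw [hfactor, sum_addChar_bilinear_unit hψ, ← Units.val_neg, sum_addChar_bilinear_unit hψ]
    have h : -((s : R) + (A * D - B * C) * (u * u) * (s⁻¹ : Rˣ)) =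
        -s + -(u * A * (u * D) * (s⁻¹ : Rˣ)) + -(u * B * (u * C) * ((-s)⁻¹ : Rˣ)) := by
      rw [inv_neg, Units.val_neg]
      ring
    rw [h, AddChar.map_add_eq_mul, AddChar.map_add_eq_mul, Units.val_neg]
    ring
  have hunits : ∑ s, ∑ m, ψ (s * (m.det - 1)) * f m =
      ∑ s : Rˣ, ∑ m, ψ (s * (m.det - 1)) * f m := by
    symm
    refine sum_of_injOn (fun s : Rˣ => (s : R)) Units.val_injective.injOn (by simp) ?_ (by simp)
    intro s _ hs
    refine hnonunit s fun hu => hs ?_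
    simpa [IsUnit] using hu
  refine mul_left_cancel₀ hcard ?_
  change (Fintype.card R : ℂ) * ∑ γ : Matrix.SpecialLinearGroup (Fin 2) R, f γ.1 = _
  rw [hsub, mul_sum]
  simp_rw [hdet]
  rw [sum_comm, hunits]
  simp_rw [hunit]
  rw [kloostermanSum, mul_sum, mul_sum]

theorem sum_norm_sq_kloostermanSum (hψ : ψ.IsPrimitive) :
    ∑ v, ‖kloostermanSum ψ v‖ ^ 2 = Fintype.card R * Fintype.card Rˣ := by
  rw [← Complex.ofReal_inj]
  push_cast
  have h (v : R) : (‖kloostermanSum ψ v‖ : ℂ) ^ 2 =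
      ∑ s : Rˣ, ∑ t : Rˣ, ψ (t - s) * ψ (v * ((t⁻¹ : Rˣ) - (s⁻¹ : Rˣ))) := by
    rw [← Complex.mul_conj', kloostermanSum, map_sum, sum_mul_sum]
    refine sum_congr rfl fun s _ => sum_congr rfl fun t _ => ?_
    rw [← AddChar.map_neg_eq_conj, ← AddChar.map_add_eq_mul, ← AddChar.map_add_eq_mul]
    congr 1
    ring
  simp_rw [h]
  rw [sum_comm]
  have h' (s t : Rˣ) : ∑ v, ψ (t - s) * ψ (v * ((t⁻¹ : Rˣ) - (s⁻¹ : Rˣ))) =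
      if s = t then (Fintype.card R : ℂ) else 0 := by
    rw [← mul_sum, AddChar.sum_mulShift _ hψ]
    have : ((t⁻¹ : Rˣ) : R) - (s⁻¹ : Rˣ) = 0 ↔ s = t := by
      rw [sub_eq_zero, Units.val_inj, inv_inj, eq_comm]
    simp only [this]
    split_ifs with hst <;> simp [hst]
  have hinner (s : Rˣ) : ∑ v, ∑ t : Rˣ, ψ (t - s) * ψ (v * ((t⁻¹ : Rˣ) - (s⁻¹ : Rˣ))) =
      Fintype.card R := by
    rw [sum_comm]
    simp_rw [h']
    simp
  simp_rw [hinner]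
  simp [mul_comm]

theorem card_mul_card_mul_card_units_le_card_specialLinearGroup :
    Fintype.card R * Fintype.card R * Fintype.card Rˣ ≤
      Fintype.card (Matrix.SpecialLinearGroup (Fin 2) R) := by
  rw [← Fintype.card_prod, ← Fintype.card_prod]
  let g : (R × R) × Rˣ → Matrix.SpecialLinearGroup (Fin 2) R := fun p =>
    ⟨!![(p.2 : R), p.1.1; p.1.2, (p.2⁻¹ : Rˣ) * (1 + p.1.1 * p.1.2)], by
      rw [Matrix.det_fin_two_of]
      linear_combination (1 + p.1.1 * p.1.2) * p.2.mul_inv⟩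
  refine Fintype.card_le_of_injective g ?_
  rintro ⟨⟨b, c⟩, a⟩ ⟨⟨b', c'⟩, a'⟩ h
  have hm := congrArg Subtype.val h
  have h00 := congrFun (congrFun hm 0) 0
  have h01 := congrFun (congrFun hm 0) 1
  have h10 := congrFun (congrFun hm 1) 0
  simp only [g, Matrix.of_apply, Matrix.cons_val', Matrix.cons_val_zero, Matrix.cons_val_one,
    Matrix.cons_val_fin_one] at h00 h01 h10
  simp [h01, h10, Units.ext h00]

end BilinearSums

section LargeSieve

/-- `e(θ) = exp (2πiθ)`. -/
noncomputable def circleExp (θ : ℝ) : ℂ :=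
  Complex.exp ((2 * Real.pi * θ : ℝ) * Complex.I)

theorem circleExp_add (θ φ : ℝ) : circleExp (θ + φ) = circleExp θ * circleExp φ := by
  rw [circleExp, circleExp, circleExp, ← Complex.exp_add]
  congr 1
  push_cast
  ring

theorem circleExp_natCast_mul (n : ℕ) (θ : ℝ) : circleExp (n * θ) = circleExp θ ^ n := by
  rw [circleExp, circleExp, ← Complex.exp_nat_mul]
  congr 1
  push_cast
  ring

theorem norm_circleExp (θ : ℝ) : ‖circleExp θ‖ = 1 :=
  Complex.norm_exp_ofReal_mul_I _

theorem conj_circleExp (θ : ℝ) : (starRingEnd ℂ) (circleExp θ) = circleExp (-θ) := by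
  rw [circleExp, circleExp, ← Complex.exp_conj, map_mul, Complex.conj_ofReal,
    Complex.conj_I]
  congr 1
  push_cast
  ring

theorem circleExp_intCast (m : ℤ) : circleExp m = 1 := by
  rw [circleExp, Complex.exp_eq_one_iff]
  exact ⟨m, by push_cast; ring⟩

theorem circleExp_fract (θ : ℝ) : circleExp (Int.fract θ) = circleExp θ := by
  conv_rhs => rw [← Int.fract_add_floor θ, circleExp_add, circleExp_intCast, mul_one]

theorem norm_circleExp_sub_one (θ : ℝ) :
    ‖circleExp θ - 1‖ = 2 * |Real.sin (Real.pi * θ)| := by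
  have h := Complex.norm_exp_I_mul_ofReal_sub_one (2 * Real.pi * θ)
  rw [circleExp, mul_comm, h, Real.norm_eq_abs, abs_mul, abs_two]
  ring_nf

/-- The geometric sum `∑_{k < K} e(kθ)`. -/
noncomputable def circleKernel (K : ℕ) (θ : ℝ) : ℂ :=
  ∑ k ∈ range K, circleExp θ ^ k

theorem norm_circleKernel_le (K : ℕ) (θ : ℝ) : ‖circleKernel K θ‖ ≤ K := by
  refine (norm_sum_le _ _).trans ?_
  simp [norm_circleExp]

theorem norm_circleKernel_mul_sin_le (K : ℕ) (θ : ℝ) :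
    |Real.sin (Real.pi * θ)| * ‖circleKernel K θ‖ ≤ 1 := by
  have h : ‖circleExp θ - 1‖ * ‖circleKernel K θ‖ ≤ 2 := by
    rw [← norm_mul, circleKernel, mul_geom_sum]
    refine (norm_sub_le _ _).trans ?_
    rw [norm_pow, norm_circleExp]
    norm_num
  rw [norm_circleExp_sub_one] at h
  linarith

theorem norm_circleKernel_sq_le_of_mem {K : ℕ} {θ : ℝ} (h0 : 0 < θ) (h1 : θ ≤ 1 / 2) :
    ‖circleKernel K θ‖ ^ 2 ≤ 1 / (4 * θ ^ 2) := by
  have hsin : 2 * θ ≤ Real.sin (Real.pi * θ) := by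
    have h := Real.mul_le_sin (x := Real.pi * θ) (by positivity) (by nlinarith [Real.pi_pos])
    rwa [← mul_assoc, div_mul_cancel₀ _ Real.pi_ne_zero] at h
  have hk := norm_circleKernel_mul_sin_le K θ
  rw [abs_of_nonneg (by linarith)] at hk
  have hk' : 2 * θ * ‖circleKernel K θ‖ ≤ 1 :=
    (mul_le_mul_of_nonneg_right hsin (norm_nonneg _)).trans hk
  rw [le_div_iff₀ (by positivity)]
  have : (2 * θ * ‖circleKernel K θ‖) ^ 2 ≤ 1 := by
    apply pow_le_one₀ (by positivity) hk'
  nlinarith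

theorem norm_circleKernel_one_sub (K : ℕ) (θ : ℝ) :
    ‖circleKernel K (1 - θ)‖ = ‖circleKernel K θ‖ := by
  have h : circleExp (1 - θ) = (starRingEnd ℂ) (circleExp θ) := by
    rw [conj_circleExp, sub_eq_add_neg, circleExp_add]
    have := circleExp_intCast 1
    norm_num at this
    rw [this, one_mul]
  rw [circleKernel, circleKernel, h]
  simp_rw [← map_pow]
  rw [← map_sum, Complex.norm_conj]

theorem circleKernel_fract (K : ℕ) (θ : ℝ) :
    circleKernel K (Int.fract θ) = circleKernel K θ := by
  rw [circleKernel, circleExp_fract, circleKernel]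

/-- A bound for `‖circleKernel K θ‖ ^ 2` when `θ` has distance at least `k / L` to `ℤ`. -/
noncomputable def kernelBound (K L k : ℕ) : ℝ :=
  if k = 0 then (K : ℝ) ^ 2 else (L : ℝ) ^ 2 / 4 * ((k : ℝ) ^ 2)⁻¹

theorem kernelBound_nonneg (K L k : ℕ) : 0 ≤ kernelBound K L k := by
  unfold kernelBound
  split_ifs <;> positivity

theorem norm_circleKernel_sq_le_kernelBound {K L k : ℕ} {θ : ℝ} (hL : 0 < L)
    (h0 : (k : ℝ) ≤ L * θ) (h1 : θ ≤ 1 / 2) :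
    ‖circleKernel K θ‖ ^ 2 ≤ kernelBound K L k := by
  unfold kernelBound
  split_ifs with hk
  · exact pow_le_pow_left₀ (norm_nonneg _) (norm_circleKernel_le K θ) 2
  · have hL' : (0 : ℝ) < L := by exact_mod_cast hL
    have hk' : (0 : ℝ) < k := by exact_mod_cast Nat.pos_of_ne_zero hk
    have hθ : 0 < θ := by
      by_contra h
      nlinarith
    refine (norm_circleKernel_sq_le_of_mem hθ h1).trans ?_
    rw [← div_eq_mul_inv, div_div, div_le_div_iff₀ (by positivity) (by positivity)]
    have := pow_le_pow_left₀ hk'.le h0 2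
    nlinarith

theorem sum_kernelBound_le (K L : ℕ) :
    ∑ k ∈ range L, kernelBound K L k ≤ (K : ℝ) ^ 2 + (L : ℝ) ^ 2 / 2 := by
  rcases L with _ | L
  · simp
  rw [sum_range_succ', add_comm]
  refine add_le_add (by simp [kernelBound]) ?_
  simp only [kernelBound, Nat.add_eq_zero_iff, one_ne_zero, and_false, if_false]
  rw [← mul_sum]
  have h : ∑ i ∈ range L, (((i + 1 : ℕ) : ℝ) ^ 2)⁻¹ ≤ 2 := by
    rcases L with _ | L
    · simp
    rw [sum_range_succ']
    have h1 := sum_Ioc_inv_sq_le_sub (α := ℝ) one_ne_zero (Nat.le_add_left 1 L)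
    have h2 : ∑ i ∈ range L, (((i + 1 + 1 : ℕ) : ℝ) ^ 2)⁻¹ =
        ∑ i ∈ Ioc 1 (L + 1), ((i : ℝ) ^ 2)⁻¹ := by
      rw [← Finset.Ico_add_one_add_one_eq_Ioc, sum_Ico_eq_sum_range]
      refine sum_congr (by simp) fun i _ => ?_
      push_cast
      ring_nf
    rw [h2]
    have : (0 : ℝ) ≤ ((L + 1 : ℕ) : ℝ)⁻¹ := by positivity
    rw [Nat.cast_one, inv_one] at h1
    have h3 : (((0 + 1 : ℕ) : ℝ) ^ 2)⁻¹ = 1 := by norm_num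
    rw [h3]
    linarith
  nlinarith [sq_nonneg (((L + 1 : ℕ) : ℝ))]

variable {ι : Type*}

theorem sum_norm_sq_circleKernel_le {s : Finset ι} {θ : ι → ℝ} {L : ℕ} (hL : 0 < L) (K : ℕ)
    (hθ : ∀ i ∈ s, ∀ j ∈ s, i ≠ j → ∀ m : ℤ, (1 : ℝ) ≤ L * |θ i - θ j - m|) (α : ℝ) :
    ∑ i ∈ s, ‖circleKernel K (θ i - α)‖ ^ 2 ≤ 2 * (K : ℝ) ^ 2 + (L : ℝ) ^ 2 := by
  have hL' : (0 : ℝ) < L := by exact_mod_cast hL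
  let k : ι → ℕ := fun i => ⌊(L : ℝ) * Int.fract (θ i - α)⌋₊
  have hkle (i : ι) : (k i : ℝ) ≤ L * Int.fract (θ i - α) :=
    Nat.floor_le (mul_nonneg hL'.le (Int.fract_nonneg _))
  have hlt (i : ι) : (L : ℝ) * Int.fract (θ i - α) < k i + 1 := Nat.lt_floor_add_one _
  have hkL (i : ι) : k i < L := by
    have := hkle i
    have h1 := mul_lt_mul_of_pos_left (Int.fract_lt_one (θ i - α)) hL'
    have h2 : (k i : ℝ) < L := by linarith
    exact_mod_cast h2
  have hinj : Set.InjOn k s := by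
    intro i hi j hj hij
    by_contra hne
    have h := hθ i hi j hj hne (⌊θ i - α⌋ - ⌊θ j - α⌋)
    have heq : θ i - θ j - ((⌊θ i - α⌋ - ⌊θ j - α⌋ : ℤ) : ℝ) =
        Int.fract (θ i - α) - Int.fract (θ j - α) := by
      rw [Int.fract, Int.fract]
      push_cast
      ring
    rw [heq] at h
    have hij' : (k i : ℝ) = k j := by rw [hij]
    have h1 := hkle i
    have h2 := hkle j
    have h3 := hlt i
    have h4 := hlt j
    have : |(L : ℝ) * (Int.fract (θ i - α) - Int.fract (θ j - α))| < 1 := by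
      rw [abs_lt]
      constructor <;> linarith
    rw [abs_mul, abs_of_pos hL'] at this
    linarith
  have hterm (i : ι) : ‖circleKernel K (θ i - α)‖ ^ 2 ≤
      kernelBound K L (L - 1 - k i) + kernelBound K L (k i) := by
    rw [← circleKernel_fract]
    rcases le_total (Int.fract (θ i - α)) (1 / 2) with h | h
    · have := norm_circleKernel_sq_le_kernelBound (K := K) hL (hkle i) h
      linarith [kernelBound_nonneg K L (L - 1 - k i)]
    · rw [← norm_circleKernel_one_sub]
      have hcast : ((L - 1 - k i : ℕ) : ℝ) = L - 1 - k i := by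
        have := hkL i
        rw [Nat.cast_sub (by omega), Nat.cast_sub (by omega), Nat.cast_one]
      have := norm_circleKernel_sq_le_kernelBound (K := K) (k := L - 1 - k i)
        (θ := 1 - Int.fract (θ i - α)) hL (by rw [hcast]; linarith [hlt i]) (by linarith)
      linarith [kernelBound_nonneg K L (k i)]
  calc ∑ i ∈ s, ‖circleKernel K (θ i - α)‖ ^ 2
      ≤ ∑ i ∈ s, (kernelBound K L (L - 1 - k i) + kernelBound K L (k i)) :=
        sum_le_sum fun i _ => hterm i
    _ = ∑ l ∈ s.image k, (kernelBound K L (L - 1 - l) + kernelBound K L l) :=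
        (sum_image (f := fun l => kernelBound K L (L - 1 - l) + kernelBound K L l) hinj).symm
    _ ≤ ∑ l ∈ range L, (kernelBound K L (L - 1 - l) + kernelBound K L l) := by
        refine sum_le_sum_of_subset_of_nonneg ?_ fun l _ _ =>
          add_nonneg (kernelBound_nonneg _ _ _) (kernelBound_nonneg _ _ _)
        intro l hl
        obtain ⟨i, -, rfl⟩ := mem_image.mp hl
        exact mem_range.mpr (hkL i)
    _ ≤ 2 * (K : ℝ) ^ 2 + (L : ℝ) ^ 2 := by
        rw [sum_add_distrib, sum_range_reflect (kernelBound K L) L]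
        linarith [sum_kernelBound_le K L]

theorem sum_sum_norm_sq_exponentialSum (s : Finset ι) (θ : ι → ℝ) (c : ι → ℂ) (K : ℕ) :
    ((∑ k ∈ range K, ∑ l ∈ range K, ‖∑ i ∈ s, c i * circleExp (((k : ℝ) - l) * θ i)‖ ^ 2 : ℝ) : ℂ) =
      ∑ i ∈ s, ∑ j ∈ s, c i * (starRingEnd ℂ) (c j) * (‖circleKernel K (θ i - θ j)‖ ^ 2 : ℝ) := by
  push_cast
  have hkl (k l : ℕ) : (‖∑ i ∈ s, c i * circleExp (((k : ℝ) - l) * θ i)‖ : ℂ) ^ 2 =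
      ∑ i ∈ s, ∑ j ∈ s, c i * (starRingEnd ℂ) (c j) *
        (circleExp (θ i - θ j) ^ k * (starRingEnd ℂ) (circleExp (θ i - θ j) ^ l)) := by
    rw [← Complex.mul_conj', map_sum, sum_mul_sum]
    refine sum_congr rfl fun i _ => sum_congr rfl fun j _ => ?_
    have h : circleExp (θ i - θ j) ^ k * (starRingEnd ℂ) (circleExp (θ i - θ j) ^ l) =
        circleExp (((k : ℝ) - l) * θ i) * (starRingEnd ℂ) (circleExp (((k : ℝ) - l) * θ j)) := by
      rw [← circleExp_natCast_mul, ← circleExp_natCast_mul, conj_circleExp, conj_circleExp,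
        ← circleExp_add, ← circleExp_add]
      ring_nf
    rw [h, map_mul]
    ring
  simp_rw [hkl]
  have hij (i j : ι) : (‖circleKernel K (θ i - θ j)‖ : ℂ) ^ 2 =
      ∑ k ∈ range K, ∑ l ∈ range K,
        circleExp (θ i - θ j) ^ k * (starRingEnd ℂ) (circleExp (θ i - θ j) ^ l) := by
    rw [← Complex.mul_conj', circleKernel, map_sum, sum_mul_sum]
  simp_rw [hij, mul_sum]
  rw [sum_congr rfl fun k _ => sum_comm, sum_comm]
  refine sum_congr rfl fun i _ => ?_
  rw [sum_congr rfl fun k _ => sum_comm, sum_comm]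

theorem sum_sum_norm_sq_exponentialSum_le {s : Finset ι} {θ : ι → ℝ} {L : ℕ} (hL : 0 < L)
    (K : ℕ) (hθ : ∀ i ∈ s, ∀ j ∈ s, i ≠ j → ∀ m : ℤ, (1 : ℝ) ≤ L * |θ i - θ j - m|)
    (c : ι → ℂ) :
    ∑ k ∈ range K, ∑ l ∈ range K, ‖∑ i ∈ s, c i * circleExp (((k : ℝ) - l) * θ i)‖ ^ 2 ≤
      (2 * (K : ℝ) ^ 2 + (L : ℝ) ^ 2) * ∑ i ∈ s, ‖c i‖ ^ 2 := by
  have hnorm := congrArg norm (sum_sum_norm_sq_exponentialSum s θ c K)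
  rw [Complex.norm_real, Real.norm_of_nonneg (by positivity)] at hnorm
  rw [hnorm]
  have hsymm (i j : ι) : ‖circleKernel K (θ i - θ j)‖ = ‖circleKernel K (θ j - θ i)‖ := by
    rw [← norm_circleKernel_one_sub, circleKernel, circleKernel]
    have h : circleExp (1 - (θ i - θ j)) = circleExp (θ j - θ i) := by
      have h1 := circleExp_intCast 1
      norm_num at h1
      rw [show 1 - (θ i - θ j) = 1 + (θ j - θ i) by ring, circleExp_add, h1, one_mul]
    rw [h]
  calc _ ≤ ∑ i ∈ s, ∑ j ∈ s, ‖c i‖ * ‖c j‖ * ‖circleKernel K (θ i - θ j)‖ ^ 2 := by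
        refine (norm_sum_le _ _).trans (sum_le_sum fun i _ => (norm_sum_le _ _).trans ?_)
        refine sum_le_sum fun j _ => ?_
        rw [norm_mul, norm_mul, Complex.norm_conj, Complex.norm_real,
          Real.norm_of_nonneg (by positivity)]
    _ ≤ ∑ i ∈ s, ∑ j ∈ s, (‖c i‖ ^ 2 / 2 * ‖circleKernel K (θ j - θ i)‖ ^ 2 +
          ‖c j‖ ^ 2 / 2 * ‖circleKernel K (θ i - θ j)‖ ^ 2) := by
        refine sum_le_sum fun i _ => sum_le_sum fun j _ => ?_
        rw [hsymm j i, ← add_mul]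
        refine mul_le_mul_of_nonneg_right ?_ (by positivity)
        nlinarith [sq_nonneg (‖c i‖ - ‖c j‖)]
    _ = ∑ i ∈ s, ‖c i‖ ^ 2 * ∑ j ∈ s, ‖circleKernel K (θ j - θ i)‖ ^ 2 := by
        simp_rw [sum_add_distrib]
        rw [sum_comm (f := fun i j => ‖c j‖ ^ 2 / 2 * ‖circleKernel K (θ i - θ j)‖ ^ 2)]
        rw [← sum_add_distrib]
        refine sum_congr rfl fun i _ => ?_
        rw [← sum_add_distrib, mul_sum]
        refine sum_congr rfl fun j _ => ?_
        ring
    _ ≤ ∑ i ∈ s, ‖c i‖ ^ 2 * (2 * (K : ℝ) ^ 2 + (L : ℝ) ^ 2) :=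
        sum_le_sum fun i _ => mul_le_mul_of_nonneg_left
          (sum_norm_sq_circleKernel_le hL K hθ (θ i)) (by positivity)
    _ = _ := by rw [← sum_mul, mul_comm]

/-- The large sieve inequality for `1 / L`-separated points. -/
theorem large_sieve {s : Finset ι} {θ : ι → ℝ} {L : ℕ} (hL : 0 < L)
    (hθ : ∀ i ∈ s, ∀ j ∈ s, i ≠ j → ∀ m : ℤ, (1 : ℝ) ≤ L * |θ i - θ j - m|)
    (c : ι → ℂ) (N : ℕ) :
    ∑ n ∈ Icc 1 N, ‖∑ i ∈ s, c i * circleExp (n * θ i)‖ ^ 2 ≤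
      9 * ((N : ℝ) + L) * ∑ i ∈ s, ‖c i‖ ^ 2 := by
  let M := N + L
  let g : ℝ → ℝ := fun x => ‖∑ i ∈ s, c i * circleExp (x * θ i)‖ ^ 2
  have hM : (0 : ℝ) < M := by
    have : 0 < M := by omega
    exact_mod_cast this
  have hle : (M : ℝ) * ∑ n ∈ Icc 1 N, g n ≤
      ∑ k ∈ range (2 * M), ∑ l ∈ range (2 * M), g ((k : ℝ) - l) := by
    rw [← sum_product']
    calc (M : ℝ) * ∑ n ∈ Icc 1 N, g n = ∑ p ∈ Icc 1 N ×ˢ range M, g p.1 := by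
          rw [sum_product, mul_sum]
          simp
      _ = ∑ p ∈ (Icc 1 N ×ˢ range M).image fun p : ℕ × ℕ => (p.1 + p.2, p.2),
            g ((p.1 : ℝ) - p.2) := by
          rw [sum_image]
          · refine sum_congr rfl fun p _ => ?_
            simp
          · rintro ⟨a, b⟩ _ ⟨a', b'⟩ _ h
            simp only [Prod.mk.injEq] at h ⊢
            omega
      _ ≤ _ := by
          refine sum_le_sum_of_subset_of_nonneg ?_ fun p _ _ => by positivity
          intro p hp
          obtain ⟨⟨a, b⟩, hab, rfl⟩ := mem_image.mp hp
          simp only [mem_product, mem_Icc, mem_range] at hab ⊢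
          omega
  have h := hle.trans (sum_sum_norm_sq_exponentialSum_le hL (2 * M) hθ c)
  have hLM : (L : ℝ) ≤ M := by
    exact_mod_cast Nat.le_add_left L N
  have hLM2 : (L : ℝ) ^ 2 ≤ (M : ℝ) ^ 2 := pow_le_pow_left₀ (by positivity) hLM 2
  have hfin : (M : ℝ) * ∑ n ∈ Icc 1 N, g n ≤ M * (9 * M * ∑ i ∈ s, ‖c i‖ ^ 2) := by
    refine h.trans ?_
    rw [← mul_assoc]
    refine mul_le_mul_of_nonneg_right ?_ (by positivity)
    push_cast
    nlinarith
  have := le_of_mul_le_mul_left hfin hM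
  simpa [M, g] using this

end LargeSieve

section DivisorBound

theorem natCast_add_one_le_mul_two_rpow {ε : ℝ} (hε : 0 < ε) (a : ℕ) :
    (a : ℝ) + 1 ≤ (1 + 1 / (ε * Real.log 2)) * 2 ^ (a * ε) := by
  have hlog : 0 < Real.log 2 := Real.log_pos one_lt_two
  have h : (a : ℝ) * (ε * Real.log 2) + 1 ≤ 2 ^ (a * ε) := by
    rw [Real.rpow_def_of_pos two_pos]
    refine le_trans (le_of_eq ?_) (Real.add_one_le_exp _)
    ring
  have ht : 0 < ε * Real.log 2 := by positivity
  have ha : (0 : ℝ) ≤ a := a.cast_nonneg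
  refine le_trans ?_ (mul_le_mul_of_nonneg_left h (by positivity))
  have : (1 + 1 / (ε * Real.log 2)) * ((a : ℝ) * (ε * Real.log 2) + 1) =
      a + 1 + (a * (ε * Real.log 2) + 1 / (ε * Real.log 2)) := by
    field_simp
    ring
  rw [this]
  have : 0 ≤ (a : ℝ) * (ε * Real.log 2) + 1 / (ε * Real.log 2) := by positivity
  linarith

/-- The divisor bound `τ(n) ≪_ε n ^ ε`. -/
theorem exists_card_divisors_le_mul_rpow {ε : ℝ} (hε : 0 < ε) :
    ∃ C : ℝ, 0 < C ∧ ∀ n : ℕ, n ≠ 0 → (#n.divisors : ℝ) ≤ C * (n : ℝ) ^ ε := by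
  set b : ℝ := 1 + 1 / (ε * Real.log 2) with hb
  have hlog : 0 < Real.log 2 := Real.log_pos one_lt_two
  have hb1 : 1 ≤ b := by
    have : 0 ≤ 1 / (ε * Real.log 2) := by positivity
    linarith
  set P : ℕ := ⌈(2 : ℝ) ^ (1 / ε)⌉₊ with hP
  refine ⟨b ^ P, by positivity, fun n hn => ?_⟩
  have hn' : (n : ℝ) ^ ε = ∏ p ∈ n.primeFactors, ((p : ℝ) ^ n.factorization p) ^ ε := by
    rw [Real.finsetProd_rpow _ _ fun p _ => by positivity]
    congr 1
    conv_lhs => rw [← Nat.prod_factorization_pow_eq_self hn]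
    rw [Finsupp.prod, Nat.support_factorization]
    push_cast
    rfl
  have hterm (p : ℕ) (hp : p ∈ n.primeFactors) : ((n.factorization p + 1 : ℕ) : ℝ) ≤
      (if p < P then b else 1) * ((p : ℝ) ^ n.factorization p) ^ ε := by
    have hp2 : (2 : ℝ) ≤ p := by exact_mod_cast (Nat.prime_of_mem_primeFactors hp).two_le
    have hrw : ((p : ℝ) ^ n.factorization p) ^ ε = (p : ℝ) ^ ((n.factorization p : ℝ) * ε) := by
      rw [Real.rpow_mul (by positivity), Real.rpow_natCast]
    push_cast
    split_ifs with h
    · refine (natCast_add_one_le_mul_two_rpow hε _).trans ?_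
      rw [hrw]
      refine mul_le_mul_of_nonneg_left ?_ (by positivity)
      exact Real.rpow_le_rpow two_pos.le hp2 (by positivity)
    · have hpε : (2 : ℝ) ≤ (p : ℝ) ^ ε := by
        have h1 : (2 : ℝ) ^ (1 / ε) ≤ p := Nat.ceil_le.mp (not_lt.mp h)
        have h2 := Real.rpow_le_rpow (by positivity) h1 hε.le
        rwa [← Real.rpow_mul two_pos.le, one_div_mul_cancel hε.ne', Real.rpow_one] at h2
      rw [one_mul, hrw, mul_comm, Real.rpow_mul (by positivity), Real.rpow_natCast]
      refine le_trans ?_ (pow_le_pow_left₀ two_pos.le hpε _)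
      exact_mod_cast Nat.succ_le_of_lt Nat.lt_two_pow_self
  rw [Nat.card_divisors hn, hn', Nat.cast_prod]
  refine (prod_le_prod (fun _ _ => by positivity) hterm).trans ?_
  rw [prod_mul_distrib]
  refine mul_le_mul_of_nonneg_right ?_ (prod_nonneg fun _ _ => by positivity)
  rw [prod_ite, prod_const, prod_const_one, mul_one]
  refine pow_le_pow_right₀ hb1 ?_
  calc #{p ∈ n.primeFactors | p < P} ≤ #(range P) :=
        card_le_card fun p hp => mem_range.mpr (mem_filter.mp hp).2
    _ = P := card_range P

theorem le_card_divisors_mul_totient {n : ℕ} (hn : n ≠ 0) : n ≤ #n.divisors * n.totient := by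
  calc n = ∑ d ∈ n.divisors, d.totient := (Nat.sum_totient n).symm
    _ ≤ ∑ _d ∈ n.divisors, n.totient := sum_le_sum fun d hd =>
        Nat.le_of_dvd (Nat.totient_pos.mpr (Nat.pos_of_ne_zero hn))
          (Nat.totient_dvd_of_dvd (Nat.dvd_of_mem_divisors hd))
    _ = #n.divisors * n.totient := by simp

end DivisorBound

section SquareRoots

theorem dvd_two_mul_sq_mul_sub {q Δ x x' y : ℤ} (hq : q ≠ 0) (hy : IsCoprime y q)
    (hx : q ∣ Δ * (x * x) - Δ * (y * y)) (hx' : q ∣ Δ * (x' * x') - Δ * (y * y))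
    (hgcd : Int.gcd (x - y) q = Int.gcd (x' - y) q) : q ∣ 2 * Δ ^ 2 * (x - x') := by
  have key {z : ℤ} (hz : q ∣ Δ * (z * z) - Δ * (y * y)) :
      ∃ e, q = Int.gcd (z - y) q * e ∧ e ∣ Δ * (z + y) := by
    obtain ⟨e, he⟩ := Int.gcd_dvd_right (z - y) q
    obtain ⟨t, ht⟩ := Int.gcd_dvd_left (z - y) q
    refine ⟨e, he, ?_⟩
    have hd : (Int.gcd (z - y) q : ℤ) ≠ 0 := fun h => hq (by rw [he, h, zero_mul])
    have hte : IsCoprime e t := by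
      have hab := Int.gcd_eq_gcd_ab (z - y) q
      refine ⟨Int.gcdB (z - y) q, Int.gcdA (z - y) q, mul_left_cancel₀ hd ?_⟩
      linear_combination -hab - Int.gcdA (z - y) q * ht - Int.gcdB (z - y) q * he
    refine hte.dvd_of_dvd_mul_left ?_
    refine (mul_dvd_mul_iff_left hd).mp ?_
    have hmul : Int.gcd (z - y) q * (t * (Δ * (z + y))) = Δ * (z * z) - Δ * (y * y) := by
      linear_combination -Δ * (z + y) * ht
    rw [← he, hmul]
    exact hz
  obtain ⟨e, he, hex⟩ := key hx
  obtain ⟨e', he', hex'⟩ := key hx'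
  rw [← hgcd] at he'
  set d : ℤ := (Int.gcd (x - y) q : ℤ) with hd_def
  have hd : d ≠ 0 := fun h => hq (by rw [he, h, zero_mul])
  have hee : e' = e := mul_left_cancel₀ hd (he'.symm.trans he)
  rw [hee] at hex'
  have hdx : d ∣ x - y := Int.gcd_dvd_left _ _
  have hdx' : d ∣ x' - y := by
    rw [hd_def, hgcd]
    exact Int.gcd_dvd_left _ _
  have hdw : d ∣ x - x' := by
    simpa using dvd_sub hdx hdx'
  have hew : e ∣ Δ * (x - x') := by
    have := dvd_sub hex hex'
    rwa [← mul_sub, add_sub_add_right_eq_sub] at this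
  have hg : (Int.gcd d e : ℤ) ∣ 2 * Δ := by
    have h1 : (Int.gcd d e : ℤ) ∣ x - y := (Int.gcd_dvd_left d e).trans hdx
    have h2 : (Int.gcd d e : ℤ) ∣ Δ * (x + y) := (Int.gcd_dvd_right d e).trans hex
    have h3 : (Int.gcd d e : ℤ) ∣ y * (2 * Δ) := by
      have := dvd_sub h2 (h1.mul_left Δ)
      have hring : Δ * (x + y) - Δ * (x - y) = y * (2 * Δ) := by ring
      rwa [hring] at this
    have h4 : (Int.gcd d e : ℤ) ∣ q := (Int.gcd_dvd_left d e).trans ⟨e, he⟩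
    exact (hy.of_isCoprime_of_dvd_right h4).symm.dvd_of_dvd_mul_left h3
  obtain ⟨m, hm⟩ := hg
  obtain ⟨w, hw⟩ := hdw
  obtain ⟨v, hv⟩ := hew
  refine ⟨m * (Int.gcdA d e * v + Int.gcdB d e * Δ * w), ?_⟩
  have hab := Int.gcd_eq_gcd_ab d e
  linear_combination Δ * (x - x') * hm + Δ * (x - x') * m * hab + m * d * Int.gcdA d e * hv +
    m * e * Int.gcdB d e * Δ * hw - m * (Int.gcdA d e * v + Int.gcdB d e * Δ * w) * he

theorem card_units_mul_sq_eq_le {q : ℕ} [NeZero q] {Δ : ℤ} (hΔ : Δ ≠ 0) (v : ZMod q) :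
    #{u : (ZMod q)ˣ | (Δ : ZMod q) * (u * u) = v} ≤ 2 * Δ.natAbs ^ 2 * #q.divisors := by
  have hq : (q : ℤ) ≠ 0 := by exact_mod_cast NeZero.ne q
  have hm : 0 < 2 * Δ.natAbs ^ 2 := by positivity
  rcases (univ.filter fun u : (ZMod q)ˣ => (Δ : ZMod q) * (u * u) = v).eq_empty_or_nonempty
    with h | ⟨u₀, hu₀⟩
  · simp [h]
  rw [mem_filter_univ] at hu₀
  let lift : (ZMod q)ˣ → ℤ := fun u => ((u : ZMod q).val : ℤ)
  have hlift (u : (ZMod q)ˣ) : ((lift u : ℤ) : ZMod q) = u := by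
    simp [lift]
  let f : (ZMod q)ˣ → ℕ := fun u => Int.gcd (lift u - lift u₀) q
  have hdvd {u : (ZMod q)ˣ} (hu : (Δ : ZMod q) * (u * u) = v) :
      (q : ℤ) ∣ Δ * (lift u * lift u) - Δ * (lift u₀ * lift u₀) := by
    rw [← ZMod.intCast_zmod_eq_zero_iff_dvd]
    push_cast
    rw [hlift, hlift, hu, hu₀, sub_self]
  have hcop : IsCoprime (lift u₀) (q : ℤ) := by
    rw [Nat.isCoprime_iff_coprime]
    exact ZMod.val_coe_unit_coprime u₀
  refine card_le_mul_card_image_of_maps_to (f := f) (fun u _ => ?_) _ fun d _ => ?_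
  · exact Nat.mem_divisors.mpr ⟨by exact_mod_cast Int.gcd_dvd_right (lift u - lift u₀) q,
      NeZero.ne q⟩
  · rcases (({u : (ZMod q)ˣ | (Δ : ZMod q) * (u * u) = v} : Finset _).filter
      fun u => f u = d).eq_empty_or_nonempty with h | ⟨u₁, hu₁⟩
    · rw [h]
      simp
    rw [mem_filter, mem_filter_univ] at hu₁
    refine le_trans ?_ (IsAddCyclic.card_nsmul_eq_zero_le (α := ZMod q) hm)
    refine card_le_card_of_injOn (fun u => (u : ZMod q) - u₁) (fun u hu => ?_)
      fun u _ u' _ h => Units.ext (sub_left_injective h)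
    rw [mem_coe, mem_filter, mem_filter_univ] at hu
    have := dvd_two_mul_sq_mul_sub hq hcop (hdvd hu.1) (hdvd hu₁.1) (hu.2.trans hu₁.2.symm)
    rw [← ZMod.intCast_zmod_eq_zero_iff_dvd] at this
    push_cast at this
    rw [hlift, hlift] at this
    rw [mem_coe, mem_filter_univ, nsmul_eq_mul, ← this]
    congr 1
    have habs : ((2 * Δ.natAbs ^ 2 : ℕ) : ℤ) = 2 * Δ ^ 2 := by
      push_cast
      rw [sq_abs]
    have hcast := congrArg (Int.cast : ℤ → ZMod q) habs
    rw [Int.cast_natCast] at hcast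
    rw [hcast]
    push_cast
    rfl

end SquareRoots

section SingularSeries

theorem sum_norm_sq_kloostermanSum_mul_sq_le {q : ℕ} [NeZero q] {Δ : ℤ} (hΔ : Δ ≠ 0) :
    ∑ u : (ZMod q)ˣ, ‖kloostermanSum ZMod.stdAddChar ((Δ : ZMod q) * ((u : ZMod q) * (u : ZMod q)))‖ ^ 2 ≤
      (2 * Δ.natAbs ^ 2 * #q.divisors : ℕ) * ((q : ℝ) * q.totient) := by
  rw [← sum_fiberwise univ (fun u : (ZMod q)ˣ => (Δ : ZMod q) * ((u : ZMod q) * (u : ZMod q)))]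
  have hparseval := sum_norm_sq_kloostermanSum (ZMod.isPrimitive_stdAddChar q)
  rw [ZMod.card, ZMod.card_units_eq_totient] at hparseval
  rw [← hparseval, mul_sum]
  refine sum_le_sum fun v _ => ?_
  have h : ∑ u ∈ univ.filter fun u : (ZMod q)ˣ => (Δ : ZMod q) * (u * u) = v,
      ‖kloostermanSum ZMod.stdAddChar ((Δ : ZMod q) * ((u : ZMod q) * (u : ZMod q)))‖ ^ 2 =
      #{u : (ZMod q)ˣ | (Δ : ZMod q) * (u * u) = v} *
        ‖kloostermanSum ZMod.stdAddChar v‖ ^ 2 := by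
    rw [← nsmul_eq_mul]
    refine sum_eq_card_nsmul fun u hu => ?_
    rw [mem_filter_univ] at hu
    rw [hu]
  rw [h]
  refine mul_le_mul_of_nonneg_right ?_ (by positivity)
  exact_mod_cast card_units_mul_sq_eq_le hΔ v

theorem sum_range_coprime {M : Type*} [AddCommMonoid M] (q : ℕ) [NeZero q] (f : ZMod q → M) :
    ∑ r ∈ (range q).filter (fun r => Nat.Coprime r q), f r = ∑ u : (ZMod q)ˣ, f u := by
  refine sum_bij' (fun r hr => ZMod.unitOfCoprime r (mem_filter.mp hr).2)
    (fun u _ => (u : ZMod q).val) (by simp) (fun u _ => ?_) (fun r hr => ?_) (fun u _ => ?_)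
    (by simp)
  · exact mem_filter.mpr ⟨mem_range.mpr (ZMod.val_lt _), ZMod.val_coe_unit_coprime u⟩
  · simpa using ZMod.val_cast_of_lt (mem_range.mp (mem_filter.mp hr).1)
  · ext
    simp

theorem ramanujanSum_eq_sum_stdAddChar {q : ℕ} [NeZero q] (x : ZMod q) :
    ramanujanSum q x =
      ∑ r ∈ (range q).filter (fun r => Nat.Coprime r q), ZMod.stdAddChar ((r : ZMod q) * x) := by
  refine sum_congr rfl fun r _ => ?_
  have h : (r : ZMod q) * x = (((r * x.val : ℕ) : ℤ) : ZMod q) := by simp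
  rw [h, ZMod.stdAddChar_coe]
  norm_cast

theorem stdAddChar_neg_mul_eq_circleExp {q : ℕ} [NeZero q] (r n : ℕ) :
    ZMod.stdAddChar (-((r : ZMod q) * (n : ZMod q))) = circleExp (n * (-(r : ℝ) / q)) := by
  have h : -((r : ZMod q) * (n : ZMod q)) = ((-(r * n) : ℤ) : ZMod q) := by simp
  rw [h, ZMod.stdAddChar_coe, circleExp]
  congr 1
  push_cast
  ring

/-- The normalised sum `|SL₂(ℤ/qℤ)|⁻¹ ∑_γ e_q(r ℒ(γ))`, with junk value `0` at `q = 0`. -/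
noncomputable def singSeriesCoeff (A B C D : ℤ) (q r : ℕ) : ℂ :=
  if h : q = 0 then 0 else
    haveI : NeZero q := ⟨h⟩
    (Fintype.card (Matrix.SpecialLinearGroup (Fin 2) (ZMod q)) : ℂ)⁻¹ *
      ∑ γ : Matrix.SpecialLinearGroup (Fin 2) (ZMod q),
        ZMod.stdAddChar ((r : ZMod q) * Lform A B C D γ)

theorem singSeriesTerm_eq_re_sum (A B C D : ℤ) {q : ℕ} (hq : q ≠ 0) (n : ℕ) :
    singSeriesTerm A B C D q n =
      (∑ r ∈ (range q).filter (fun r => Nat.Coprime r q),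
        singSeriesCoeff A B C D q r * circleExp (n * (-(r : ℝ) / q))).re := by
  have : NeZero q := ⟨hq⟩
  simp only [singSeriesTerm, singSeriesCoeff, dif_neg hq, ramanujanSum_eq_sum_stdAddChar]
  rw [sum_comm, mul_sum]
  congr 1
  refine sum_congr rfl fun r _ => ?_
  rw [mul_assoc, sum_mul]
  congr 1
  refine sum_congr rfl fun γ _ => ?_
  rw [← stdAddChar_neg_mul_eq_circleExp, ← AddChar.map_add_eq_mul]
  congr 1
  push_cast
  ring

theorem sum_norm_sq_singSeriesCoeff_le {A B C D : ℤ}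
    (hgcd : Int.gcd A (Int.gcd B (Int.gcd C D)) = 1) (hΔ : A * D - B * C ≠ 0)
    {q : ℕ} (hq : q ≠ 0) :
    ∑ r ∈ (range q).filter (fun r => Nat.Coprime r q), ‖singSeriesCoeff A B C D q r‖ ^ 2 ≤
      2 * ((A * D - B * C).natAbs : ℝ) ^ 2 * (#q.divisors : ℝ) ^ 2 / (q : ℝ) ^ 2 := by
  have : NeZero q := ⟨hq⟩
  obtain ⟨w, x, y, z, hprim⟩ : ∃ w x y z : ℤ, w * A + x * B + y * C + z * D = 1 := by
    have h1 := Int.gcd_eq_gcd_ab A (Int.gcd B (Int.gcd C D))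
    have h2 := Int.gcd_eq_gcd_ab B (Int.gcd C D)
    have h3 := Int.gcd_eq_gcd_ab C D
    rw [hgcd, Nat.cast_one] at h1
    set g : ℤ := (Int.gcd C D : ℤ)
    set g' : ℤ := (Int.gcd B g : ℤ)
    refine ⟨Int.gcdA A g', Int.gcdB A g' * Int.gcdA B g,
      Int.gcdB A g' * Int.gcdB B g * Int.gcdA C D, Int.gcdB A g' * Int.gcdB B g * Int.gcdB C D, ?_⟩
    linear_combination -h1 - Int.gcdB A g' * h2 - Int.gcdB A g' * Int.gcdB B g * h3
  have hprim' : (w : ZMod q) * A + x * B + y * C + z * D = 1 := by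
    exact_mod_cast congrArg (Int.cast : ℤ → ZMod q) hprim
  set S : ℕ := Fintype.card (Matrix.SpecialLinearGroup (Fin 2) (ZMod q)) with hS
  have hcoeff (u : (ZMod q)ˣ) :
      ‖(S : ℂ)⁻¹ * ∑ γ : Matrix.SpecialLinearGroup (Fin 2) (ZMod q),
        ZMod.stdAddChar ((u : ZMod q) * Lform A B C D γ)‖ ^ 2 =
      (q : ℝ) ^ 2 / (S : ℝ) ^ 2 * ‖kloostermanSum ZMod.stdAddChar
        (((A * D - B * C : ℤ) : ZMod q) * ((u : ZMod q) * (u : ZMod q)))‖ ^ 2 := by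
    simp only [Lform]
    rw [sum_specialLinearGroup_addChar (ZMod.isPrimitive_stdAddChar q) hprim' u, ZMod.card]
    push_cast
    rw [norm_mul, norm_mul, norm_inv, Complex.norm_natCast, Complex.norm_natCast]
    ring
  have hsum : ∑ r ∈ (range q).filter (fun r => Nat.Coprime r q),
      ‖singSeriesCoeff A B C D q r‖ ^ 2 =
      (q : ℝ) ^ 2 / (S : ℝ) ^ 2 * ∑ u : (ZMod q)ˣ, ‖kloostermanSum ZMod.stdAddChar
        (((A * D - B * C : ℤ) : ZMod q) * ((u : ZMod q) * (u : ZMod q)))‖ ^ 2 := by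
    simp only [singSeriesCoeff, dif_neg hq]
    rw [sum_range_coprime q fun t => ‖(S : ℂ)⁻¹ *
      ∑ γ : Matrix.SpecialLinearGroup (Fin 2) (ZMod q),
        ZMod.stdAddChar (t * Lform A B C D γ)‖ ^ 2, mul_sum]
    exact sum_congr rfl fun u _ => hcoeff u
  have hcard : (q : ℝ) * q * q.totient ≤ S := by
    have := card_mul_card_mul_card_units_le_card_specialLinearGroup (R := ZMod q)
    rw [ZMod.card, ZMod.card_units_eq_totient] at this
    exact_mod_cast this
  have hq0 : (0 : ℝ) < q := by exact_mod_cast Nat.pos_of_ne_zero hq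
  have hφ : (0 : ℝ) < q.totient := by
    exact_mod_cast Nat.totient_pos.mpr (Nat.pos_of_ne_zero hq)
  have hτ : (q : ℝ) ≤ #q.divisors * q.totient := by
    exact_mod_cast le_card_divisors_mul_totient hq
  set m : ℝ := 2 * ((A * D - B * C).natAbs : ℝ) ^ 2 * #q.divisors with hm
  have hm0 : 0 ≤ m := by positivity
  have hkl := sum_norm_sq_kloostermanSum_mul_sq_le (q := q) hΔ
  push_cast only [Nat.cast_mul, Nat.cast_pow, Nat.cast_ofNat] at hkl
  rw [hsum]
  calc _ ≤ (q : ℝ) ^ 2 / ((q : ℝ) * q * q.totient) ^ 2 * (m * ((q : ℝ) * q.totient)) := by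
        refine mul_le_mul ?_ hkl (sum_nonneg fun _ _ => by positivity) (by positivity)
        gcongr
    _ = m / q * (1 / q.totient) := by
        field_simp
    _ ≤ m / q * (#q.divisors / q) := by
        refine mul_le_mul_of_nonneg_left ?_ (by positivity)
        rw [div_le_div_iff₀ hφ hq0]
        linarith
    _ = _ := by
        rw [hm]
        ring

theorem one_le_sq_mul_abs_farey_sub {q q' r r' H : ℕ} (hq : q ≠ 0) (hq' : q' ≠ 0)
    (hqH : q < 2 * H) (hqH' : q' < 2 * H) (hr : r < q) (hr' : r' < q')
    (hc : r.Coprime q) (hc' : r'.Coprime q') (hne : ¬(q = q' ∧ r = r')) (m : ℤ) :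
    (1 : ℝ) ≤ ((2 * H) ^ 2 : ℕ) * |-(r : ℝ) / q - -(r' : ℝ) / q' - m| := by
  have hq0 : (0 : ℝ) < q := by exact_mod_cast Nat.pos_of_ne_zero hq
  have hq0' : (0 : ℝ) < q' := by exact_mod_cast Nat.pos_of_ne_zero hq'
  let t : ℤ := -(r * q') + r' * q - m * (q * q')
  have ht : t ≠ 0 := by
    intro h
    have hdvd : (q : ℤ) ∣ q' := by
      have : IsCoprime (q : ℤ) r := (Nat.isCoprime_iff_coprime.mpr hc).symm
      exact this.dvd_of_dvd_mul_left ⟨r' - m * q', by linear_combination -h⟩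
    have hdvd' : (q' : ℤ) ∣ q := by
      have : IsCoprime (q' : ℤ) r' := (Nat.isCoprime_iff_coprime.mpr hc').symm
      exact this.dvd_of_dvd_mul_left ⟨r + m * q, by linear_combination h⟩
    have hqq : q = q' := Nat.dvd_antisymm (by exact_mod_cast hdvd) (by exact_mod_cast hdvd')
    subst hqq
    refine hne ⟨rfl, ?_⟩
    have hmod : (r : ℤ) - r' = -m * q := by
      have hqz : (q : ℤ) ≠ 0 := by exact_mod_cast hq
      refine mul_right_cancel₀ hqz ?_
      linear_combination -h
    have : r ≡ r' [MOD q] := by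
      rw [← Int.natCast_modEq_iff]
      exact (Int.modEq_iff_dvd.mpr ⟨-m, by rw [hmod]; ring⟩ : (r' : ℤ) ≡ r [ZMOD q]).symm
    exact this.eq_of_lt_of_lt hr hr'
  have heq : -(r : ℝ) / q - -(r' : ℝ) / q' - m = t / (q * q') := by
    simp only [t]
    push_cast
    field_simp
    ring
  have ht1 : (1 : ℝ) ≤ |(t : ℝ)| := by exact_mod_cast Int.one_le_abs ht
  rw [heq, abs_div, abs_of_pos (mul_pos hq0 hq0'), mul_div_assoc', le_div_iff₀ (by positivity),
    one_mul]
  have hle : (q : ℝ) * q' ≤ ((2 * H) ^ 2 : ℕ) := by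
    rw [sq]
    exact_mod_cast Nat.mul_le_mul hqH.le hqH'.le
  exact hle.trans (le_mul_of_one_le_right (by positivity) ht1)

theorem sum_sq_abs_singSeriesTerm_le (A B C D : ℤ) {H : ℕ} (hH : 1 ≤ H) (N : ℕ) :
    ∑ n ∈ Icc 1 N, |∑ q ∈ Ico H (2 * H), singSeriesTerm A B C D q (n : ℤ)| ^ 2 ≤
      9 * ((N : ℝ) + ((2 * H) ^ 2 : ℕ)) * ∑ q ∈ Ico H (2 * H),
        ∑ r ∈ (range q).filter (fun r => Nat.Coprime r q), ‖singSeriesCoeff A B C D q r‖ ^ 2 := by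
  let s : Finset (Σ _ : ℕ, ℕ) :=
    (Ico H (2 * H)).sigma fun q => (range q).filter fun r => Nat.Coprime r q
  have hls := large_sieve (s := s) (θ := fun i => -(i.2 : ℝ) / i.1) (L := (2 * H) ^ 2)
    (by positivity) ?_ (fun i => singSeriesCoeff A B C D i.1 i.2) N
  · rw [sum_sigma] at hls
    refine le_trans (sum_le_sum fun n _ => ?_) hls
    have h : ∑ q ∈ Ico H (2 * H), singSeriesTerm A B C D q (n : ℤ) =
        (∑ i ∈ s, singSeriesCoeff A B C D i.1 i.2 * circleExp (n * (-(i.2 : ℝ) / i.1))).re := by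
      rw [sum_sigma, Complex.re_sum]
      refine sum_congr rfl fun q hq => ?_
      exact singSeriesTerm_eq_re_sum A B C D (by have := (mem_Ico.mp hq).1; omega) n
    rw [h]
    exact pow_le_pow_left₀ (abs_nonneg _) (Complex.abs_re_le_norm _) 2
  · rintro ⟨q, r⟩ hi ⟨q', r'⟩ hj hne m
    simp only [s, mem_sigma, mem_Ico, mem_filter, mem_range] at hi hj
    refine one_le_sq_mul_abs_farey_sub (by omega) (by omega) hi.1.2 hj.1.2 hi.2.1 hj.2.1 hi.2.2
      hj.2.2 ?_ m
    rintro ⟨rfl, rfl⟩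
    exact hne rfl

end SingularSeries

end Auxiliary

/-- Mean-square bound for dyadic pieces of the singular series, `Δ = AD − BC ≠ 0`:
`Σ_{n ≤ N} |Σ_{H ≤ q < 2H} 𝔖_q(n)|² ≪_ε H^ε (H + N H^{−1/2})`. -/
theorem singSeries_dyadic_mean_square (A B C D : ℤ)
    (hgcd : Int.gcd A (Int.gcd B (Int.gcd C D)) = 1) (hΔ : A * D - B * C ≠ 0)
    (ε : ℝ) (hε : 0 < ε) :
    ∃ K : ℝ, 0 < K ∧ ∀ N H : ℕ, 1 ≤ N → 1 ≤ H →
      (∑ n ∈ Finset.Icc 1 N,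
          |∑ q ∈ Finset.Ico H (2 * H), singSeriesTerm A B C D q (n : ℤ)| ^ 2) ≤
        K * (H : ℝ) ^ ε * ((H : ℝ) + (N : ℝ) * (H : ℝ) ^ (-(1 : ℝ) / 2)) := by
  obtain ⟨T, hT, hdiv⟩ := exists_card_divisors_le_mul_rpow (half_pos hε)
  set m : ℝ := 2 * ((A * D - B * C).natAbs : ℝ) ^ 2 with hm
  have hm0 : 0 < m := by
    have : (0 : ℝ) < (A * D - B * C).natAbs := by exact_mod_cast Int.natAbs_pos.mpr hΔ
    positivity
  refine ⟨36 * (m * T ^ 2 * 2 ^ ε), by positivity, fun N H _ hH => ?_⟩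
  have hH1 : (1 : ℝ) ≤ H := by exact_mod_cast hH
  have hH0 : (0 : ℝ) < H := by linarith
  have hterm (q : ℕ) (hq : q ∈ Finset.Ico H (2 * H)) :
      ∑ r ∈ (Finset.range q).filter (fun r => Nat.Coprime r q),
        ‖singSeriesCoeff A B C D q r‖ ^ 2 ≤ m * T ^ 2 * 2 ^ ε * (H : ℝ) ^ ε / (H : ℝ) ^ 2 := by
    rw [Finset.mem_Ico] at hq
    have hq0 : q ≠ 0 := by omega
    have hqH : (H : ℝ) ≤ q := by exact_mod_cast hq.1
    have hqH' : (q : ℝ) ≤ 2 * H := by exact_mod_cast hq.2.le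
    refine (sum_norm_sq_singSeriesCoeff_le hgcd hΔ hq0).trans ?_
    have hτ : (q.divisors.card : ℝ) ^ 2 ≤ T ^ 2 * 2 ^ ε * (H : ℝ) ^ ε := by
      calc (q.divisors.card : ℝ) ^ 2 ≤ (T * (q : ℝ) ^ (ε / 2)) ^ 2 :=
            pow_le_pow_left₀ (by positivity) (hdiv q hq0) 2
        _ = T ^ 2 * (q : ℝ) ^ ε := by
            rw [mul_pow, ← Real.rpow_natCast ((q : ℝ) ^ (ε / 2)), ← Real.rpow_mul (by positivity)]
            norm_num
        _ ≤ T ^ 2 * (2 * (H : ℝ)) ^ ε := by gcongr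
        _ = T ^ 2 * 2 ^ ε * (H : ℝ) ^ ε := by
            rw [Real.mul_rpow two_pos.le hH0.le, mul_assoc]
    calc m * (q.divisors.card : ℝ) ^ 2 / (q : ℝ) ^ 2
        ≤ m * (T ^ 2 * 2 ^ ε * (H : ℝ) ^ ε) / (H : ℝ) ^ 2 := by gcongr
      _ = _ := by ring
  have hsum := Finset.sum_le_sum hterm
  rw [Finset.sum_const, Nat.card_Ico, nsmul_eq_mul, show 2 * H - H = H by omega] at hsum
  refine (sum_sq_abs_singSeriesTerm_le A B C D hH N).trans ?_
  have hpow : (H : ℝ)⁻¹ ≤ (H : ℝ) ^ (-(1 : ℝ) / 2) := by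
    rw [← Real.rpow_neg_one]
    exact Real.rpow_le_rpow_of_exponent_le hH1 (by norm_num)
  calc _ ≤ 9 * ((N : ℝ) + ((2 * H) ^ 2 : ℕ)) *
          (H * (m * T ^ 2 * 2 ^ ε * (H : ℝ) ^ ε / (H : ℝ) ^ 2)) := by gcongr
    _ = m * T ^ 2 * 2 ^ ε * (H : ℝ) ^ ε * (36 * H + 9 * (N * (H : ℝ)⁻¹)) := by
        push_cast
        field_simp
        ring
    _ ≤ m * T ^ 2 * 2 ^ ε * (H : ℝ) ^ ε *
          (36 * (H + N * (H : ℝ) ^ (-(1 : ℝ) / 2))) := by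
        have hN : (N : ℝ) * (H : ℝ)⁻¹ ≤ N * (H : ℝ) ^ (-(1 : ℝ) / 2) :=
          mul_le_mul_of_nonneg_left hpow N.cast_nonneg
        have : (0 : ℝ) ≤ N * (H : ℝ)⁻¹ := by positivity
        refine mul_le_mul_of_nonneg_left ?_ (by positivity)
        linarith
    _ = _ := by ring
end

section
/- Let Δ be a nonzero integer. For every ε > 0 there is a constant C = C(ε, Δ) such that for all integers N ≥ 1 and all squarefree positive integers q, the number of pairs of integers (n, m) with N ≤ n ≤ 2N and n² − q·m² = 4Δ is at most C · N^ε. -/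
/-- The second coordinate of a solution of `n² − q·m² = 4Δ` with `n ≤ 2N` is `O_Δ(N)`. -/
theorem pell_abs_snd_le {Δ q N n m : ℤ} (hN : 1 ≤ N) (hq : 1 ≤ q) (hn : N ≤ n)
    (hn' : n ≤ 2 * N) (h : n ^ 2 - q * m ^ 2 = 4 * Δ) : |m| ≤ (2 + 2 * |Δ|) * N := by
  refine abs_le_of_sq_le_sq ?_ (by positivity)
  have hm : m ^ 2 ≤ q * m ^ 2 := le_mul_of_one_le_left (sq_nonneg m) hq
  have hn2 : n ^ 2 ≤ (2 * N) ^ 2 := pow_le_pow_left₀ (by lia) hn' 2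
  have hN2 : |Δ| ≤ |Δ| * N ^ 2 := le_mul_of_one_le_right (abs_nonneg Δ) (one_le_pow₀ hN)
  have hΔ : 0 ≤ |Δ| * N ^ 2 := by positivity
  have hΔ2 : 0 ≤ (|Δ| * N) ^ 2 := sq_nonneg _
  have := neg_abs_le Δ
  nlinarith

/-- If `u + v√q` is the quotient of two solutions of `n² − q·m² = 4Δ` lying in the same dyadic
range and having second coordinates of the same sign, then `u` is bounded in terms of `Δ`. -/
theorem pell_quotient_abs_fst_le {Δ q N n₁ m₁ n₂ m₂ u : ℤ} (hΔ : Δ ≠ 0) (hN : 1 ≤ N)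
    (hq : 0 ≤ q) (hn₁ : N ≤ n₁) (hn₁' : n₁ ≤ 2 * N) (hn₂ : N ≤ n₂) (hn₂' : n₂ ≤ 2 * N)
    (hm : 0 ≤ m₁ * m₂) (h₁ : n₁ ^ 2 - q * m₁ ^ 2 = 4 * Δ) (h₂ : n₂ ^ 2 - q * m₂ ^ 2 = 4 * Δ)
    (hu : n₁ * n₂ - q * (m₁ * m₂) = 4 * Δ * u) : |u| ≤ 8 + 4 * |Δ| := by
  have key : u * (n₁ * n₂ + q * (m₁ * m₂)) = n₁ ^ 2 + n₂ ^ 2 - 4 * Δ := by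
    refine mul_left_cancel₀ (mul_ne_zero four_ne_zero hΔ) ?_
    linear_combination (-(n₁ * n₂ + q * (m₁ * m₂))) * hu + (n₂ ^ 2 - 4 * Δ) * h₁ +
      (q * m₁ ^ 2) * h₂
  have hden : N ^ 2 ≤ n₁ * n₂ + q * (m₁ * m₂) := by
    have := mul_nonneg hq hm
    nlinarith
  have hN2 : 0 < N ^ 2 := by positivity
  refine le_of_mul_le_mul_right ?_ hN2
  calc |u| * N ^ 2 ≤ |u| * (n₁ * n₂ + q * (m₁ * m₂)) := by gcongr
    _ = |n₁ ^ 2 + n₂ ^ 2 - 4 * Δ| := by rw [← key, abs_mul, abs_of_pos (hN2.trans_le hden)]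
    _ ≤ (8 + 4 * |Δ|) * N ^ 2 := by
      have hΔN : |Δ| ≤ |Δ| * N ^ 2 := le_mul_of_one_le_right (abs_nonneg Δ) (one_le_pow₀ hN)
      have := neg_abs_le Δ
      have := le_abs_self Δ
      have hs₁ : n₁ ^ 2 ≤ (2 * N) ^ 2 := pow_le_pow_left₀ (by lia) hn₁' 2
      have hs₂ : n₂ ^ 2 ≤ (2 * N) ^ 2 := pow_le_pow_left₀ (by lia) hn₂' 2
      rw [abs_le]
      constructor <;> nlinarith

/-- If `u + v√q` is the quotient of two solutions of `n² − q·m² = 4Δ` lying in the same dyadic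
range and having nonnegative second coordinates, then `v` is bounded in terms of `Δ`. -/
theorem pell_quotient_abs_snd_le {Δ q N n₁ m₁ n₂ m₂ v : ℤ} (hΔ : Δ ≠ 0) (hN : 1 ≤ N)
    (hq : 1 ≤ q) (hn₁ : N ≤ n₁) (hn₁' : n₁ ≤ 2 * N) (hn₂ : N ≤ n₂) (hn₂' : n₂ ≤ 2 * N)
    (hm₁ : 0 ≤ m₁) (hm₂ : 0 ≤ m₂) (h₁ : n₁ ^ 2 - q * m₁ ^ 2 = 4 * Δ)
    (h₂ : n₂ ^ 2 - q * m₂ ^ 2 = 4 * Δ) (hv : m₁ * n₂ - n₁ * m₂ = 4 * Δ * v) :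
    |v| ≤ 2 + 2 * |Δ| := by
  have key : v * (m₁ * n₂ + n₁ * m₂) = (m₁ - m₂) * (m₁ + m₂) := by
    refine mul_left_cancel₀ (mul_ne_zero four_ne_zero hΔ) ?_
    linear_combination (-(m₁ * n₂ + n₁ * m₂)) * hv + m₁ ^ 2 * h₂ - m₂ ^ 2 * h₁
  have hb₁ := pell_abs_snd_le hN hq hn₁ hn₁' h₁
  have hb₂ := pell_abs_snd_le hN hq hn₂ hn₂' h₂
  rw [abs_of_nonneg hm₁] at hb₁
  rw [abs_of_nonneg hm₂] at hb₂
  rcases (add_nonneg hm₁ hm₂).eq_or_lt with h0 | hpos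
  · obtain rfl : m₁ = 0 := by lia
    obtain rfl : m₂ = 0 := by lia
    have : v = 0 := by simpa [hΔ] using hv
    rw [this, abs_zero]
    positivity
  have hden : N * (m₁ + m₂) ≤ m₁ * n₂ + n₁ * m₂ := by nlinarith
  have hNm : 0 < N * (m₁ + m₂) := by positivity
  refine le_of_mul_le_mul_right ?_ hNm
  calc |v| * (N * (m₁ + m₂)) ≤ |v| * (m₁ * n₂ + n₁ * m₂) := by gcongr
    _ = |m₁ - m₂| * (m₁ + m₂) := by
      rw [← abs_of_pos (hNm.trans_le hden), ← abs_mul, key, abs_mul, abs_of_pos hpos]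
    _ ≤ ((2 + 2 * |Δ|) * N) * (m₁ + m₂) := by
      gcongr
      exact abs_sub_le_of_nonneg_of_le hm₁ hb₁ hm₂ hb₂
    _ = (2 + 2 * |Δ|) * (N * (m₁ + m₂)) := by ring

/-- Two solutions of `n² − q·m² = 4Δ` that are congruent modulo `4Δ` have an integral quotient. -/
theorem pell_exists_quotient {Δ q n₁ m₁ n₂ m₂ : ℤ} (h₂ : n₂ ^ 2 - q * m₂ ^ 2 = 4 * Δ)
    (hn : 4 * Δ ∣ n₁ - n₂) (hm : 4 * Δ ∣ m₁ - m₂) :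
    ∃ u v : ℤ, n₁ * n₂ - q * (m₁ * m₂) = 4 * Δ * u ∧ m₁ * n₂ - n₁ * m₂ = 4 * Δ * v := by
  obtain ⟨a, ha⟩ := hn
  obtain ⟨b, hb⟩ := hm
  refine ⟨1 + a * n₂ - q * b * m₂, b * n₂ - a * m₂, ?_, ?_⟩
  · linear_combination n₂ * ha - q * m₂ * hb + h₂
  · linear_combination n₂ * hb - m₂ * ha

/-- The solutions of `n² − q·m² = 4Δ` in a dyadic range, within one residue class modulo `4Δ` and
with a prescribed sign of `m`, are `O_Δ(1)` in number. -/
theorem pell_card_le_of_congruent {Δ q N : ℤ} (hΔ : Δ ≠ 0) (hN : 1 ≤ N) (hq : 1 ≤ q)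
    (s : Finset (ℤ × ℤ))
    (hs : ∀ p ∈ s, N ≤ p.1 ∧ p.1 ≤ 2 * N ∧ p.1 ^ 2 - q * p.2 ^ 2 = 4 * Δ)
    (hcong : ∀ p ∈ s, ∀ p' ∈ s, 4 * Δ ∣ p.1 - p'.1 ∧ 4 * Δ ∣ p.2 - p'.2 ∧ (0 ≤ p.2 ↔ 0 ≤ p'.2)) :
    s.card ≤ (Finset.Icc (-(8 + 4 * |Δ|)) (8 + 4 * |Δ|) ×ˢ
      Finset.Icc (-(2 + 2 * |Δ|)) (2 + 2 * |Δ|)).card := by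
  obtain rfl | ⟨⟨n₂, m₂⟩, hp₂⟩ := s.eq_empty_or_nonempty
  · simp
  obtain ⟨hn₂, hn₂', h₂⟩ := hs _ hp₂
  have hquot : ∀ p ∈ s, ∃ w : ℤ × ℤ, p.1 * n₂ - q * (p.2 * m₂) = 4 * Δ * w.1 ∧
      p.2 * n₂ - p.1 * m₂ = 4 * Δ * w.2 := fun p hp ↦ by
    obtain ⟨hn, hm, -⟩ := hcong p hp _ hp₂
    obtain ⟨u, v, huv⟩ := pell_exists_quotient h₂ hn hm
    exact ⟨(u, v), huv⟩
  choose! w hw₁ hw₂ using hquot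
  refine Finset.card_le_card_of_injOn w ?_ ?_
  · rintro ⟨n₁, m₁⟩ hp₁
    obtain ⟨hn₁, hn₁', h₁⟩ := hs _ hp₁
    have hsign : 0 ≤ m₁ ↔ 0 ≤ m₂ := (hcong _ hp₁ _ hp₂).2.2
    have hu := hw₁ _ hp₁
    have hv := hw₂ _ hp₁
    dsimp only at hn₁ hn₁' h₁ hn₂ hn₂' h₂ hu hv
    rw [Finset.mem_coe, Finset.mem_product, Finset.mem_Icc, Finset.mem_Icc, ← abs_le, ← abs_le]
    rcases le_or_gt 0 m₂ with hm₂ | hm₂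
    · have hm₁ := hsign.2 hm₂
      exact ⟨pell_quotient_abs_fst_le hΔ hN (by lia) hn₁ hn₁' hn₂ hn₂' (mul_nonneg hm₁ hm₂) h₁ h₂ hu,
        pell_quotient_abs_snd_le hΔ hN hq hn₁ hn₁' hn₂ hn₂' hm₁ hm₂ h₁ h₂ hv⟩
    · have hm₁ : m₁ < 0 := by lia
      refine ⟨pell_quotient_abs_fst_le hΔ hN (by lia) hn₁ hn₁' hn₂ hn₂'
        (mul_nonneg_of_nonpos_of_nonpos hm₁.le hm₂.le) h₁ h₂ hu, ?_⟩
      rw [← abs_neg]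
      exact pell_quotient_abs_snd_le hΔ hN hq hn₁ hn₁' hn₂ hn₂' (neg_nonneg.2 hm₁.le)
        (neg_nonneg.2 hm₂.le) (by rwa [neg_sq]) (by rwa [neg_sq]) (by linear_combination -hv)
  · intro p hp p' hp' hpp
    have hu := hw₁ p hp
    have hv := hw₂ p hp
    have hu' := hw₁ p' hp'
    have hv' := hw₂ p' hp'
    rw [hpp] at hu hv
    have h4 : 4 * Δ ≠ 0 := mul_ne_zero four_ne_zero hΔ
    ext <;> refine mul_left_cancel₀ h4 ?_
    · linear_combination n₂ * (hu - hu') + q * m₂ * (hv - hv') - (p.1 - p'.1) * h₂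
    · linear_combination m₂ * (hu - hu') + n₂ * (hv - hv') - (p.2 - p'.2) * h₂

/-- For fixed `Δ ≠ 0`, the number of solutions of `n² − q·m² = 4Δ` in a dyadic range is bounded
uniformly in the range and in `q ≥ 1`. -/
theorem exists_pell_ncard_le {Δ : ℤ} (hΔ : Δ ≠ 0) :
    ∃ K : ℕ, ∀ N q : ℤ, 1 ≤ N → 1 ≤ q →
      {p : ℤ × ℤ | N ≤ p.1 ∧ p.1 ≤ 2 * N ∧ p.1 ^ 2 - q * p.2 ^ 2 = 4 * Δ}.ncard ≤ K := by
  have : NeZero (4 * Δ).natAbs := ⟨Int.natAbs_ne_zero.2 (mul_ne_zero four_ne_zero hΔ)⟩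
  let R := ZMod (4 * Δ).natAbs
  let c := (Finset.Icc (-(8 + 4 * |Δ|)) (8 + 4 * |Δ|) ×ˢ
    Finset.Icc (-(2 + 2 * |Δ|)) (2 + 2 * |Δ|)).card
  refine ⟨c * Fintype.card (R × R × Bool), fun N q hN hq ↦ ?_⟩
  set S := {p : ℤ × ℤ | N ≤ p.1 ∧ p.1 ≤ 2 * N ∧ p.1 ^ 2 - q * p.2 ^ 2 = 4 * Δ}
  have hfin : S.Finite := by
    refine ((Set.finite_Icc N (2 * N)).prod
      (Set.finite_Icc (-((2 + 2 * |Δ|) * N)) ((2 + 2 * |Δ|) * N))).subset fun p hp ↦ ?_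
    exact ⟨⟨hp.1, hp.2.1⟩, abs_le.1 (pell_abs_snd_le hN hq hp.1 hp.2.1 hp.2.2)⟩
  rw [Set.ncard_eq_toFinset_card S hfin]
  let f : ℤ × ℤ → R × R × Bool := fun p ↦ (p.1, p.2, decide (0 ≤ p.2))
  have hdvd : ∀ a b : ℤ, (a : R) = b → 4 * Δ ∣ a - b := fun a b hab ↦ by
    rw [← Int.natAbs_dvd]
    exact (ZMod.intCast_eq_intCast_iff_dvd_sub b a _).1 hab.symm
  refine Finset.card_le_mul_card_image_of_maps_to (f := f) (fun p _ ↦ Finset.mem_univ _) c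
    fun b _ ↦ pell_card_le_of_congruent hΔ hN hq _ (fun p hp ↦ ?_) fun p hp p' hp' ↦ ?_
  · exact hfin.mem_toFinset.1 (Finset.mem_filter.1 hp).1
  · have h := (Finset.mem_filter.1 hp).2.trans (Finset.mem_filter.1 hp').2.symm
    simp only [f, Prod.mk.injEq, decide_eq_decide] at h
    exact ⟨hdvd _ _ h.1, hdvd _ _ h.2.1, h.2.2⟩

/-- For fixed `Δ ≠ 0` and any squarefree `q`, the number of solutions `(n, m)` to the
Pell-type equation `n² − q·m² = 4Δ` with `N ≤ n ≤ 2N` is `O_ε(N^ε)`. -/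
theorem pell_type_solution_count (Δ : ℤ) (hΔ : Δ ≠ 0) (ε : ℝ) (hε : 0 < ε) :
    ∃ K : ℝ, 0 < K ∧ ∀ N : ℕ, 1 ≤ N → ∀ q : ℕ, Squarefree q →
      (Set.ncard {nm : ℤ × ℤ | (N : ℤ) ≤ nm.1 ∧ nm.1 ≤ 2 * (N : ℤ) ∧
          nm.1 ^ 2 - (q : ℤ) * nm.2 ^ 2 = 4 * Δ} : ℝ) ≤ K * (N : ℝ) ^ ε := by
  obtain ⟨K, hK⟩ := exists_pell_ncard_le hΔ
  refine ⟨K + 1, by positivity, fun N hN q hq ↦ ?_⟩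
  have hcount := hK N q (by exact_mod_cast hN)
    (by exact_mod_cast Nat.one_le_iff_ne_zero.2 hq.ne_zero)
  have hNε : 1 ≤ (N : ℝ) ^ ε := Real.one_le_rpow (by exact_mod_cast hN) hε.le
  calc _ ≤ (K : ℝ) := by exact_mod_cast hcount
    _ ≤ K + 1 := by simp
    _ ≤ (K + 1) * (N : ℝ) ^ ε := le_mul_of_one_le_right (by positivity) hNε
end

section
/- Let A, B, D, P be integers with B ≠ 0 and P ≠ 0. There is a constant C depending only on B and P such that the following holds. Let γ = (a, b; c, d) and γ' = (a', b'; c', d') be 2×2 integer matrices with a·d − b·c = 1, a'·d' − b'·c' = 1 and c' = c, let k, ℓ, k', ℓ' be integers, and let m be a positive divisor of B·c·P². Then the number of r ∈ (ℤ/mℤ)ˣ satisfying the four congruences −ℓ ≡ P·r·(B·a + D·c), −k ≡ P·r·(A·c + B·d), −ℓ' ≡ P·r·(B·a' + D·c), and −k' ≡ P·r·(A·c + B·d') modulo m is at most C. -/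
/-- A set of residues below `m` whose `N`-multiples all agree modulo `m` has at most `N` elements. -/
theorem Finset.card_le_of_mul_modEq {m N : ℕ} (hN : 0 < N) (s : Finset ℕ)
    (hs : ∀ r ∈ s, r < m) (h : ∀ r ∈ s, ∀ t ∈ s, N * r ≡ N * t [MOD m]) : s.card ≤ N := by
  rw [← Finset.card_range N]
  refine Finset.card_le_card_of_injOn (fun r => N * r / m) (fun r hr => ?_) fun r hr t ht hrt => ?_
  · exact Finset.mem_coe.2 (Finset.mem_range.2
      (Nat.div_lt_of_lt_mul (by nlinarith [hs r hr])))
  · have hmod : N * r % m = N * t % m := h r hr t ht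
    have hdiv : N * r / m = N * t / m := hrt
    refine Nat.eq_of_mul_eq_mul_left hN ?_
    rw [← Nat.div_add_mod (N * r) m, ← Nat.div_add_mod (N * t) m, hmod, hdiv]

/-- If `m` divides `B * c * P ^ 2` and `P * x * (B * a + D * c)` with `a`, `c` coprime, then `m`
divides `(P * B) ^ 2 * x`. -/
theorem Int.dvd_sq_mul_of_dvd_mul_add {B P D a b c d m x : ℤ} (hdet : a * d - b * c = 1)
    (hm : m ∣ B * c * P ^ 2) (hx : m ∣ P * x * (B * a + D * c)) : m ∣ (P * B) ^ 2 * x := by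
  have hcomb : (P * B) ^ 2 * x = P * x * (B * a + D * c) * (P * B * d)
      + B * c * P ^ 2 * (-(x * (D * d + B * b))) := by
    linear_combination (-(P ^ 2 * B ^ 2 * x)) * hdet
  rw [hcomb]
  exact dvd_add (hx.mul_right _) (hm.mul_right _)


open scoped Classical in
/-- For `m ∣ BcP²`, the number of units `r (mod m)` satisfying the four congruences
`−ℓ ≡ Pr(Ba+Dc)`, `−k ≡ Pr(Ac+Bd)`, `−ℓ' ≡ Pr(Ba'+Dc)`, `−k' ≡ Pr(Ac+Bd')` mod `m`
is bounded by a constant depending only on `B` and `P`. -/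
theorem count_units_satisfying_congruences (B P : ℤ) (hB : B ≠ 0) (hP : P ≠ 0) :
    ∃ K : ℕ, 0 < K ∧ ∀ (A D a b c d a' b' c' d' k ℓ k' ℓ' : ℤ) (m : ℕ), 0 < m →
      (m : ℤ) ∣ B * c * P ^ 2 → a * d - b * c = 1 → a' * d' - b' * c' = 1 → c' = c →
      ((Finset.range m).filter (fun r => Nat.Coprime r m ∧
          (-ℓ ≡ P * (r : ℤ) * (B * a + D * c) [ZMOD (m : ℤ)]) ∧
          (-k ≡ P * (r : ℤ) * (A * c + B * d) [ZMOD (m : ℤ)]) ∧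
          (-ℓ' ≡ P * (r : ℤ) * (B * a' + D * c) [ZMOD (m : ℤ)]) ∧
          (-k' ≡ P * (r : ℤ) * (A * c + B * d') [ZMOD (m : ℤ)]))).card ≤ K := by
  have hN : 0 < ((P * B) ^ 2).natAbs := Int.natAbs_pos.2 (pow_ne_zero 2 (mul_ne_zero hP hB))
  refine ⟨_, hN, ?_⟩
  intro A D a b c d a' b' c' d' k ℓ k' ℓ' m _ hm hdet _ _
  refine Finset.card_le_of_mul_modEq hN _
    (fun r hr => Finset.mem_range.1 (Finset.mem_filter.1 hr).1) fun r hr t ht => ?_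
  have hr := (Finset.mem_filter.1 hr).2.2.1
  have ht := (Finset.mem_filter.1 ht).2.2.1
  have hdvd := (hr.symm.trans ht).dvd
  have hx : (m : ℤ) ∣ P * ((t : ℤ) - r) * (B * a + D * c) := by
    convert hdvd using 1
    ring
  rw [← Int.natCast_modEq_iff, Int.modEq_iff_dvd]
  push_cast
  rw [abs_of_nonneg (sq_nonneg (P * B)), ← mul_sub]
  exact Int.dvd_sq_mul_of_dvd_mul_add hdet hm hx
end
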